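/- Let W ∈ ℝ^{m×n}, let A, B ∈ ℝ^{n×l} be such that BBᵀ is invertible, let k ∈ ℕ, and let L_B ∈ ℝ^{n×n} be any invertible matrix satisfying BBᵀ = L_B L_Bᵀ. Then the matrix W'* := SVD_k(W A Bᵀ (BBᵀ)^{-1} L_B) · L_B^{-1} satisfies rank(W'*) ≤ k and minimizes ‖W A − W' B‖_F² over all W' ∈ ℝ^{m×n} with rank(W') ≤ k. -/

import Mathlib

open Matrix

noncomputable section

/-- The squared Frobenius norm of a real matrix. -/
def frobSq {m n : ℕ} (M : Matrix (Fin m) (Fin n) ℝ) : ℝ := ∑ i, ∑ j, (M i j) ^ 2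

/-- The m×n rectangular diagonal matrix whose (i,i) entry (0-based) is `s (i+1)`,
so that `s` gives the 1-indexed diagonal values `s 1, s 2, …`. -/
def rectDiag (m n : ℕ) (s : ℕ → ℝ) : Matrix (Fin m) (Fin n) ℝ :=
  Matrix.of fun i j => if (i : ℕ) = (j : ℕ) then s ((i : ℕ) + 1) else 0

/-- `IsSVD m n W U s V` says that `W = U Σ Vᵀ` is a singular value decomposition of `W`:
`U` and `V` are orthogonal and `s 1 ≥ s 2 ≥ ⋯ ≥ 0` are the (1-indexed) singular values
of `W` arranged in nonincreasing order along the rectangular diagonal `Σ`. -/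
structure IsSVD (m n : ℕ) (W : Matrix (Fin m) (Fin n) ℝ)
    (U : Matrix (Fin m) (Fin m) ℝ) (s : ℕ → ℝ) (V : Matrix (Fin n) (Fin n) ℝ) : Prop where
  orthU : Uᵀ * U = 1
  orthV : Vᵀ * V = 1
  nonneg : ∀ i, 0 ≤ s i
  mono : ∀ i j, i ≤ j → s j ≤ s i
  decomp : W = U * rectDiag m n s * Vᵀ

/-- The rank-`k` truncation `U Σₖ Vᵀ` of a singular value decomposition,
retaining only the top-`k` singular values `s 1, …, s k`. -/
def svdTrunc (m n k : ℕ) (U : Matrix (Fin m) (Fin m) ℝ) (s : ℕ → ℝ)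
    (V : Matrix (Fin n) (Fin n) ℝ) : Matrix (Fin m) (Fin n) ℝ :=
  U * rectDiag m n (fun i => if i ≤ k then s i else 0) * Vᵀ

theorem frobSq_eq_trace {m n : ℕ} (M : Matrix (Fin m) (Fin n) ℝ) :
    frobSq M = (Mᵀ * M).trace := by
  simp only [frobSq, Matrix.trace, Matrix.diag, Matrix.mul_apply, Matrix.transpose_apply]
  rw [Finset.sum_comm]
  simp only [sq]

theorem frobSq_nonneg {m n : ℕ} (M : Matrix (Fin m) (Fin n) ℝ) : 0 ≤ frobSq M :=
  Finset.sum_nonneg fun _ _ => Finset.sum_nonneg fun _ _ => sq_nonneg _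

theorem frobSq_transpose {m n : ℕ} (M : Matrix (Fin m) (Fin n) ℝ) : frobSq Mᵀ = frobSq M := by
  simp only [frobSq, Matrix.transpose_apply]
  exact Finset.sum_comm

theorem frobSq_mul_left {m n p : ℕ} {E : Matrix (Fin m) (Fin n) ℝ} (hE : Eᵀ * E = 1)
    (M : Matrix (Fin n) (Fin p) ℝ) : frobSq (E * M) = frobSq M := by
  rw [frobSq_eq_trace, frobSq_eq_trace, Matrix.transpose_mul, Matrix.mul_assoc,
    ← Matrix.mul_assoc Eᵀ, hE, Matrix.one_mul]

theorem frobSq_mul_transpose_right {m n p : ℕ} {E : Matrix (Fin m) (Fin n) ℝ} (hE : Eᵀ * E = 1)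
    (M : Matrix (Fin p) (Fin n) ℝ) : frobSq (M * Eᵀ) = frobSq M := by
  rw [← frobSq_transpose, Matrix.transpose_mul, Matrix.transpose_transpose, frobSq_mul_left hE,
    frobSq_transpose]

/-- Pythagoras for the least-squares problem with orthonormal columns `E`. -/
theorem frobSq_sub_mul_left {m n p : ℕ} {E : Matrix (Fin m) (Fin n) ℝ} (hE : Eᵀ * E = 1)
    (Y : Matrix (Fin m) (Fin p) ℝ) (F : Matrix (Fin n) (Fin p) ℝ) :
    frobSq (Y - E * F) = frobSq Y - frobSq (Eᵀ * Y) + frobSq (Eᵀ * Y - F) := by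
  have hFF : Fᵀ * Eᵀ * (E * F) = Fᵀ * F := by
    rw [Matrix.mul_assoc, ← Matrix.mul_assoc Eᵀ, hE, Matrix.one_mul]
  simp only [frobSq_eq_trace, Matrix.transpose_sub, Matrix.transpose_mul,
    Matrix.transpose_transpose, Matrix.sub_mul, Matrix.mul_sub, Matrix.trace_sub, hFF]
  simp only [Matrix.mul_assoc]
  ring

/-- Pythagoras for the least-squares problem with orthonormal rows `Q`. -/
theorem frobSq_sub_mul_right {m n p : ℕ} {Q : Matrix (Fin n) (Fin p) ℝ} (hQ : Q * Qᵀ = 1)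
    (Y : Matrix (Fin m) (Fin p) ℝ) (X : Matrix (Fin m) (Fin n) ℝ) :
    frobSq (Y - X * Q) = frobSq Y - frobSq (Y * Qᵀ) + frobSq (Y * Qᵀ - X) := by
  have h := frobSq_sub_mul_left (E := Qᵀ) (by simpa using hQ) Yᵀ Xᵀ
  rwa [← Matrix.transpose_mul, ← Matrix.transpose_sub, ← Matrix.transpose_mul,
    ← Matrix.transpose_sub, frobSq_transpose, frobSq_transpose, frobSq_transpose,
    frobSq_transpose] at h

/-- A matrix factors through its rank, with orthonormal columns in the left factor. -/
theorem exists_orthonormal_factor {m n : ℕ} (Z : Matrix (Fin m) (Fin n) ℝ) :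
    ∃ (E : Matrix (Fin m) (Fin Z.rank) ℝ) (F : Matrix (Fin Z.rank) (Fin n) ℝ),
      Eᵀ * E = 1 ∧ Z = E * F := by
  let e := (WithLp.linearEquiv 2 ℝ (Fin m → ℝ)).symm
  let S : Submodule ℝ (EuclideanSpace ℝ (Fin m)) := (LinearMap.range Z.mulVecLin).map e.toLinearMap
  have hS : Module.finrank ℝ S = Z.rank := LinearEquiv.finrank_map_eq e _
  let o := (stdOrthonormalBasis ℝ S).reindex (finCongr hS)
  have hcol (j : Fin n) : e (Z.col j) ∈ S :=
    Submodule.mem_map_of_mem ⟨Pi.single j 1, by simp⟩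
  refine ⟨Matrix.of fun i a => (o a : EuclideanSpace ℝ (Fin m)) i,
    Matrix.of fun a j => o.repr ⟨_, hcol j⟩ a, ?_, ?_⟩
  · ext a b
    have h := orthonormal_iff_ite.mp o.orthonormal b a
    rw [Submodule.coe_inner, PiLp.inner_apply] at h
    simpa [Matrix.mul_apply, Matrix.one_apply, eq_comm] using h
  · ext i j
    have h := congrArg (fun x : S => (x : EuclideanSpace ℝ (Fin m)) i) (o.sum_repr ⟨_, hcol j⟩)
    simp only [Submodule.coe_sum, Submodule.coe_smul, WithLp.ofLp_sum, Finset.sum_apply,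
      PiLp.smul_apply, smul_eq_mul] at h
    rw [Matrix.mul_apply]
    exact h.symm.trans (Finset.sum_congr rfl fun a _ => mul_comm _ _)

theorem gram_diag_nonneg {m d : ℕ} (E : Matrix (Fin m) (Fin d) ℝ) (i : Fin m) :
    0 ≤ (E * Eᵀ) i i := by
  simp only [Matrix.mul_apply, Matrix.transpose_apply]
  exact Finset.sum_nonneg fun _ _ => mul_self_nonneg _

theorem gram_diag_le_one {m d : ℕ} {E : Matrix (Fin m) (Fin d) ℝ} (hE : Eᵀ * E = 1) (i : Fin m) :
    (E * Eᵀ) i i ≤ 1 := by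
  have hP : E * Eᵀ * (E * Eᵀ)ᵀ = E * Eᵀ := by
    rw [Matrix.transpose_mul, Matrix.transpose_transpose, Matrix.mul_assoc, ← Matrix.mul_assoc Eᵀ,
      hE, Matrix.one_mul]
  have h : ∑ j, (E * Eᵀ) i j * (E * Eᵀ) i j = (E * Eᵀ) i i := by
    simpa only [Matrix.mul_apply (M := E * Eᵀ), Matrix.transpose_apply] using
      congrFun (congrFun hP i) i
  have h' := Finset.single_le_sum (f := fun j => (E * Eᵀ) i j * (E * Eᵀ) i j)
    (fun j _ => mul_self_nonneg _) (Finset.mem_univ i)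
  simp only [h] at h'
  nlinarith

theorem sum_gram_diag {m d : ℕ} {E : Matrix (Fin m) (Fin d) ℝ} (hE : Eᵀ * E = 1) :
    ∑ i, (E * Eᵀ) i i = d := by
  have h := Matrix.trace_mul_comm E Eᵀ
  rw [hE, Matrix.trace_one, Fintype.card_fin] at h
  exact h

/-- Weights in `[0, 1]` of total mass at most `k` weigh an antitone nonnegative sequence by at most
the sum of its first `k` terms. -/
theorem sum_mul_le_sum_top {m k : ℕ} {p : Fin m → ℝ} (hp0 : ∀ i, 0 ≤ p i) (hp1 : ∀ i, p i ≤ 1)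
    (hpk : ∑ i, p i ≤ k) {t : ℕ → ℝ} (ht0 : ∀ i, 0 ≤ t i) (ht : Antitone t) :
    ∑ i : Fin m, p i * t i ≤ ∑ i : Fin m, if (i : ℕ) < k then t i else 0 := by
  rcases le_or_gt m k with hmk | hkm
  · refine Finset.sum_le_sum fun i _ => ?_
    rw [if_pos (i.2.trans_le hmk)]
    exact mul_le_of_le_one_left (ht0 _) (hp1 i)
  · have hcard : ∑ i : Fin m, (if (i : ℕ) < k then (1 : ℝ) else 0) = k := by
      rw [Fin.sum_univ_eq_sum_range (fun i => if i < k then (1 : ℝ) else 0), ← Finset.sum_filter]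
      have : (Finset.range m).filter (· < k) = Finset.range k := by
        ext i; simp only [Finset.mem_filter, Finset.mem_range]; omega
      simp [this]
    have hle : ∑ i : Fin m, p i * (t i - t k) ≤
        ∑ i : Fin m, (if (i : ℕ) < k then (1 : ℝ) else 0) * (t i - t k) := by
      refine Finset.sum_le_sum fun i _ => ?_
      split_ifs with h
      · exact mul_le_mul_of_nonneg_right (hp1 i) (sub_nonneg.mpr (ht h.le))
      · rw [zero_mul]
        exact mul_nonpos_of_nonneg_of_nonpos (hp0 i) (sub_nonpos.mpr (ht (not_lt.mp h)))
    simp only [mul_sub, Finset.sum_sub_distrib, ← Finset.sum_mul, hcard] at hle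
    simp only [ite_mul, one_mul, zero_mul] at hle
    have := mul_le_mul_of_nonneg_right hpk (ht0 k)
    linarith

theorem rectDiag_mul_transpose (m n : ℕ) (s : ℕ → ℝ) :
    rectDiag m n s * (rectDiag m n s)ᵀ =
      Matrix.diagonal fun i : Fin m => if (i : ℕ) < n then s (i + 1) ^ 2 else 0 := by
  ext i i'
  simp only [Matrix.mul_apply, Matrix.transpose_apply, rectDiag, Matrix.of_apply,
    Matrix.diagonal_apply]
  by_cases hin : (i : ℕ) < n
  · rw [Finset.sum_eq_single ⟨i, hin⟩ (fun j _ hj => by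
      rw [if_neg (fun h => hj (Fin.ext h.symm)), zero_mul]) (by simp)]
    rcases eq_or_ne i i' with rfl | h
    · simp [hin, sq]
    · simp [h, Fin.val_ne_of_ne h.symm]
  · refine (Finset.sum_eq_zero fun j _ => ?_).trans (by simp [hin])
    rw [if_neg (by omega), zero_mul]

theorem frobSq_mul_rectDiag {m n d : ℕ} (E : Matrix (Fin m) (Fin d) ℝ) (s : ℕ → ℝ) :
    frobSq (Eᵀ * rectDiag m n s) =
      ∑ i : Fin m, (E * Eᵀ) i i * if (i : ℕ) < n then s (i + 1) ^ 2 else 0 := by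
  rw [frobSq_eq_trace, Matrix.trace_mul_comm, Matrix.transpose_mul, Matrix.transpose_transpose,
    ← Matrix.mul_assoc, Matrix.mul_assoc Eᵀ, rectDiag_mul_transpose, Matrix.mul_assoc,
    Matrix.trace_mul_comm, Matrix.mul_assoc, Matrix.trace_mul_comm]
  simp [Matrix.trace, Matrix.mul_diagonal]

theorem frobSq_rectDiag (m n : ℕ) (s : ℕ → ℝ) :
    frobSq (rectDiag m n s) = ∑ i : Fin m, if (i : ℕ) < n then s (i + 1) ^ 2 else 0 := by
  simpa using frobSq_mul_rectDiag (n := n) (1 : Matrix (Fin m) (Fin m) ℝ) s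

theorem rectDiag_sub (m n : ℕ) (s t : ℕ → ℝ) :
    rectDiag m n s - rectDiag m n t = rectDiag m n (s - t) := by
  ext i j
  by_cases h : (i : ℕ) = j <;> simp [rectDiag, h]

theorem frobSq_rectDiag_sub_trunc_le {m n k : ℕ} {s : ℕ → ℝ} (hs0 : ∀ i, 0 ≤ s i)
    (hs : Antitone s) (Z : Matrix (Fin m) (Fin n) ℝ) (hZ : Z.rank ≤ k) :
    frobSq (rectDiag m n s - rectDiag m n fun i => if i ≤ k then s i else 0) ≤
      frobSq (rectDiag m n s - Z) := by
  obtain ⟨E, F, hE, hEF⟩ := exists_orthonormal_factor Z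
  let t : ℕ → ℝ := fun i => if i < n then s (i + 1) ^ 2 else 0
  have ht0 (i : ℕ) : 0 ≤ t i := by
    dsimp only [t]
    split_ifs
    exacts [sq_nonneg _, le_rfl]
  have ht : Antitone t := by
    intro i j hij
    by_cases hj : j < n
    · simpa only [t, if_pos hj, if_pos (hij.trans_lt hj)] using
        pow_le_pow_left₀ (hs0 _) (hs (Nat.add_le_add_right hij 1)) 2
    · simpa only [t, if_neg hj] using ht0 i
  have hbound : frobSq (Eᵀ * rectDiag m n s) ≤ ∑ i : Fin m, if (i : ℕ) < k then t i else 0 := by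
    rw [frobSq_mul_rectDiag]
    refine sum_mul_le_sum_top (gram_diag_nonneg E) (gram_diag_le_one hE) ?_ ht0 ht
    rw [sum_gram_diag hE]
    exact_mod_cast hZ
  have htail : frobSq (rectDiag m n s - rectDiag m n fun i => if i ≤ k then s i else 0) =
      frobSq (rectDiag m n s) - ∑ i : Fin m, if (i : ℕ) < k then t i else 0 := by
    rw [rectDiag_sub, frobSq_rectDiag, frobSq_rectDiag, ← Finset.sum_sub_distrib]
    refine Finset.sum_congr rfl fun i _ => ?_
    by_cases hk : (i : ℕ) < k
    · simp [t, hk, Nat.succ_le_of_lt hk]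
    · simp [t, hk]
  have hsplit := frobSq_sub_mul_left hE (rectDiag m n s) F
  rw [← hEF] at hsplit
  have := frobSq_nonneg (Eᵀ * rectDiag m n s - F)
  linarith

/-- The Eckart–Young theorem for the Frobenius norm. -/
theorem IsSVD.frobSq_sub_svdTrunc_le {m n k : ℕ} {M : Matrix (Fin m) (Fin n) ℝ}
    {U : Matrix (Fin m) (Fin m) ℝ} {s : ℕ → ℝ} {V : Matrix (Fin n) (Fin n) ℝ}
    (h : IsSVD m n M U s V) (X : Matrix (Fin m) (Fin n) ℝ) (hX : X.rank ≤ k) :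
    frobSq (M - svdTrunc m n k U s V) ≤ frobSq (M - X) := by
  have hrot (Z : Matrix (Fin m) (Fin n) ℝ) :
      frobSq (M - U * Z * Vᵀ) = frobSq (rectDiag m n s - Z) := by
    rw [h.decomp, ← Matrix.sub_mul, ← Matrix.mul_sub, frobSq_mul_transpose_right h.orthV,
      frobSq_mul_left h.orthU]
  have hXeq : X = U * (Uᵀ * X * V) * Vᵀ := by
    have hU : U * Uᵀ = 1 := mul_eq_one_comm.mp h.orthU
    have hV : V * Vᵀ = 1 := mul_eq_one_comm.mp h.orthV
    simp only [Matrix.mul_assoc, hV, Matrix.mul_one]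
    rw [← Matrix.mul_assoc, hU, Matrix.one_mul]
  rw [svdTrunc, hrot, hXeq, hrot]
  exact frobSq_rectDiag_sub_trunc_le h.nonneg (fun i j hij => h.mono i j hij) _
    (((Matrix.rank_mul_le_left _ _).trans (Matrix.rank_mul_le_right _ _)).trans hX)

theorem rank_rectDiag_trunc_le (m n k : ℕ) (s : ℕ → ℝ) :
    (rectDiag m n fun i => if i ≤ k then s i else 0).rank ≤ k := by
  have hfac : (rectDiag m n fun i => if i ≤ k then s i else 0) =
      rectDiag m k s * rectDiag k n 1 := by
    ext i j
    simp only [Matrix.mul_apply, rectDiag, Matrix.of_apply, Pi.one_apply]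
    by_cases hik : (i : ℕ) < k
    · rw [Finset.sum_eq_single ⟨i, hik⟩ (fun a _ ha => by
        rw [if_neg (fun h => ha (Fin.ext h.symm)), zero_mul]) (by simp)]
      simp [Nat.succ_le_of_lt hik]
    · rw [Finset.sum_eq_zero fun a _ => by rw [if_neg (by omega), zero_mul]]
      simp [hik]
  rw [hfac]
  exact (Matrix.rank_mul_le_left _ _).trans (Matrix.rank_le_width _)

theorem rank_svdTrunc_le (m n k : ℕ) (U : Matrix (Fin m) (Fin m) ℝ) (s : ℕ → ℝ)
    (V : Matrix (Fin n) (Fin n) ℝ) : (svdTrunc m n k U s V).rank ≤ k :=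
  ((Matrix.rank_mul_le_left _ _).trans (Matrix.rank_mul_le_right _ _)).trans
    (rank_rectDiag_trunc_le m n k s)

/-- Anchored low-rank regression: with `B Bᵀ` invertible and `B Bᵀ = L Lᵀ` for an
invertible `L`, the matrix `W'* = SVD_k(W A Bᵀ (B Bᵀ)⁻¹ L) L⁻¹` has rank at most `k`
and minimizes `‖W A − W' B‖_F²` over all `W'` of rank at most `k`. -/
theorem anchored_lowrank_solution {m n l k : ℕ}
    (W : Matrix (Fin m) (Fin n) ℝ) (A B : Matrix (Fin n) (Fin l) ℝ)
    (hBB : IsUnit (B * Bᵀ).det)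
    (L : Matrix (Fin n) (Fin n) ℝ) (hL : IsUnit L.det) (hfac : B * Bᵀ = L * Lᵀ)
    (U : Matrix (Fin m) (Fin m) ℝ) (s : ℕ → ℝ) (V : Matrix (Fin n) (Fin n) ℝ)
    (hSVD : IsSVD m n (W * A * Bᵀ * (B * Bᵀ)⁻¹ * L) U s V) :
    (svdTrunc m n k U s V * L⁻¹).rank ≤ k ∧
    ∀ W' : Matrix (Fin m) (Fin n) ℝ, W'.rank ≤ k →
      frobSq (W * A - (svdTrunc m n k U s V * L⁻¹) * B) ≤ frobSq (W * A - W' * B) := by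
  refine ⟨(Matrix.rank_mul_le_left _ _).trans (rank_svdTrunc_le m n k U s V), fun W' hW' => ?_⟩
  have hLt : IsUnit Lᵀ.det := by rwa [Matrix.det_transpose]
  have hQ : (L⁻¹ * B) * (L⁻¹ * B)ᵀ = 1 := by
    rw [Matrix.transpose_mul, Matrix.mul_assoc, ← Matrix.mul_assoc B, hfac,
      Matrix.transpose_nonsing_inv, Matrix.mul_assoc, Matrix.mul_nonsing_inv _ hLt, Matrix.mul_one,
      Matrix.nonsing_inv_mul _ hL]
  have hM : W * A * Bᵀ * (B * Bᵀ)⁻¹ * L = W * A * (L⁻¹ * B)ᵀ := by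
    rw [hfac, Matrix.mul_inv_rev, Matrix.transpose_mul, Matrix.transpose_nonsing_inv]
    simp only [Matrix.mul_assoc, Matrix.nonsing_inv_mul _ hL, Matrix.mul_one]
  have hW : W' * B = W' * L * (L⁻¹ * B) := by
    rw [Matrix.mul_assoc, ← Matrix.mul_assoc L, Matrix.mul_nonsing_inv _ hL, Matrix.one_mul]
  rw [hM] at hSVD
  rw [hW, Matrix.mul_assoc _ L⁻¹ B, frobSq_sub_mul_right hQ, frobSq_sub_mul_right hQ]
  gcongr
  exact hSVD.frobSq_sub_svdTrunc_le _ ((Matrix.rank_mul_le_left _ _).trans hW')
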